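/- For every 3 < p ≤ ∞ there exists a constant M_p > 0 depending only on p such that for every divergence-free Schwartz vector field u : ℝ³ → ℝ³ with vorticity ω = ∇×u, one has (1/M_p) ‖ω‖_{Ḃ^{−2+3/p}_{p,∞}} ≤ ‖u‖_{Ḃ^{−1+3/p}_{p,∞}} ≤ M_p ‖ω‖_{Ḃ^{−2+3/p}_{p,∞}}, where ‖f‖_{Ḃ^{−s}_{p,∞}} = sup_{t>0} t^{s/2} ‖e^{tΔ}f‖_{L^p(ℝ³)}. -/

import Mathlib

open MeasureTheory Real SchwartzMap
open scoped FourierTransform ENNReal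

noncomputable section

/-- Euclidean three-space. -/
abbrev E3 : Type := EuclideanSpace ℝ (Fin 3)

/-- The `i`-th standard basis vector. -/
def ee (i : Fin 3) : E3 := EuclideanSpace.single i 1

/-- The partial derivative `∂ᵢ f`. -/
def pd (i : Fin 3) (f : E3 → ℝ) : E3 → ℝ := fun x => fderiv ℝ f x (ee i)

/-- The curl `ω = ∇ × u` of a vector field. -/
def curl (u : Fin 3 → E3 → ℝ) : Fin 3 → E3 → ℝ :=
  ![fun x => pd 1 (u 2) x - pd 2 (u 1) x,
    fun x => pd 2 (u 0) x - pd 0 (u 2) x,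
    fun x => pd 0 (u 1) x - pd 1 (u 0) x]

/-- The heat kernel `G(x,t) = (4πt)^{-3/2} exp(−|x|²/(4t))` on `ℝ³`. -/
def heatKernel (t : ℝ) (x : E3) : ℝ :=
  (4 * π * t) ^ (-(3 : ℝ) / 2) * Real.exp (-‖x‖ ^ 2 / (4 * t))

/-- The heat semigroup `e^{tΔ}` applied componentwise to a vector field. -/
def heatV (t : ℝ) (v : Fin 3 → E3 → ℝ) : E3 → E3 :=
  fun x => (EuclideanSpace.equiv (Fin 3) ℝ).symm
    (fun i => ∫ y : E3, heatKernel t (x - y) * v i y)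

/-- The homogeneous Besov norm `‖f‖_{Ḃ^{−s}_{p,∞}} = sup_{t>0} t^{s/2}‖e^{tΔ}f‖_{L^p}`
of a vector field. -/
def besov (s : ℝ) (p : ℝ≥0∞) (f : Fin 3 → E3 → ℝ) : ℝ≥0∞ :=
  ⨆ t : Set.Ioi (0 : ℝ), ENNReal.ofReal ((t : ℝ) ^ (s / 2)) * eLpNorm (heatV t f) p volume

section helpers

theorem mink {α β : Type*} [MeasurableSpace α] [MeasurableSpace β] (μ : Measure α) (ν : Measure β)
    [SFinite μ] [IsFiniteMeasure ν] (F : α → β → ℝ≥0∞) (hF : Measurable (Function.uncurry F))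
    (p : ℝ≥0∞) (hp : 1 ≤ p) (B : ℝ≥0∞) (hB : ∀ᵐ z ∂ν, eLpNorm (fun x => F x z) p μ ≤ B) :
    eLpNorm (fun x => ∫⁻ z, F x z ∂ν) p μ ≤ ν Set.univ * B := by
  rcases eq_or_ne p ∞ with rfl | hpt
  · simp only [eLpNorm_exponent_top] at hB ⊢
    have h1 : ∀ᵐ z ∂ν, ∀ᵐ x ∂μ, F x z ≤ B := by
      filter_upwards [hB] with z hz
      filter_upwards [enorm_ae_le_eLpNormEssSup (fun x => F x z) μ] with x hx
      exact le_trans hx hz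
    have hm : MeasurableSet {x : α × β | F x.1 x.2 ≤ B} := hF measurableSet_Iic
    have h2 : ∀ᵐ x ∂μ, ∀ᵐ z ∂ν, F x z ≤ B := by
      rw [Measure.ae_ae_comm hm]; exact h1
    refine essSup_le_of_ae_le _ ?_
    filter_upwards [h2] with x hx
    calc _ ≤ ∫⁻ z, B ∂ν := lintegral_mono_ae hx
      _ = _ := by rw [lintegral_const, mul_comm]
  · have hp0 : p ≠ 0 := (zero_lt_one.trans_le hp).ne'
    have hr : 0 < p.toReal := ENNReal.toReal_pos hp0 hpt
    have hr1 : 1 ≤ p.toReal := by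
      have := ENNReal.toReal_mono hpt hp; simpa using this
    have key : ∀ x, (∫⁻ z, F x z ∂ν) ^ p.toReal ≤
        ν Set.univ ^ (p.toReal - 1) * ∫⁻ z, F x z ^ p.toReal ∂ν := by
      intro x
      have hm : Measurable (F x) := hF.comp measurable_prodMk_left
      have h := eLpNorm_le_eLpNorm_mul_rpow_measure_univ (μ := ν) (f := F x) hp
        hm.aestronglyMeasurable
      rw [eLpNorm_one_eq_lintegral_enorm, eLpNorm_eq_lintegral_rpow_enorm_toReal hp0 hpt] at h
      simp only [enorm_eq_self, ENNReal.toReal_one] at h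
      calc _ ≤ _ := ENNReal.rpow_le_rpow h hr.le
        _ = _ := by
          rw [ENNReal.mul_rpow_of_nonneg _ _ hr.le, ← ENNReal.rpow_mul, ← ENNReal.rpow_mul, mul_comm]
          congr 2
          · field_simp
          · rw [one_div, inv_mul_cancel₀ hr.ne', ENNReal.rpow_one]
    have hB' : ∀ᵐ z ∂ν, ∫⁻ x, F x z ^ p.toReal ∂μ ≤ B ^ p.toReal := by
      filter_upwards [hB] with z hz
      rw [eLpNorm_eq_lintegral_rpow_enorm_toReal hp0 hpt] at hz
      have := ENNReal.rpow_le_rpow hz hr.le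
      rwa [← ENNReal.rpow_mul, one_div, inv_mul_cancel₀ hr.ne', ENNReal.rpow_one] at this
    rw [eLpNorm_eq_lintegral_rpow_enorm_toReal hp0 hpt]
    simp only [enorm_eq_self]
    have hFr : Measurable (Function.uncurry fun x z => F x z ^ p.toReal) := hF.pow_const _
    have : ∫⁻ x, (∫⁻ z, F x z ∂ν) ^ p.toReal ∂μ ≤ (ν Set.univ * B) ^ p.toReal := by
      calc _ ≤ ∫⁻ x, ν Set.univ ^ (p.toReal - 1) * ∫⁻ z, F x z ^ p.toReal ∂ν ∂μ := lintegral_mono key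
        _ = ν Set.univ ^ (p.toReal - 1) * ∫⁻ z, ∫⁻ x, F x z ^ p.toReal ∂μ ∂ν := by
          have hm : Measurable fun x => ∫⁻ z, F x z ^ p.toReal ∂ν := hFr.lintegral_prod_right'
          rw [lintegral_const_mul _ hm, lintegral_lintegral_swap hFr.aemeasurable]
        _ ≤ ν Set.univ ^ (p.toReal - 1) * ∫⁻ z, B ^ p.toReal ∂ν := by
          gcongr 1; exact lintegral_mono_ae hB'
        _ = ν Set.univ ^ (p.toReal - 1) * ν Set.univ ^ (1:ℝ) * B ^ p.toReal := by
          rw [lintegral_const, ENNReal.rpow_one]; ring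
        _ = _ := by
          rw [← ENNReal.rpow_add_of_nonneg _ _ (by linarith) zero_le_one,
            ENNReal.mul_rpow_of_nonneg _ _ hr.le, sub_add_cancel]
    calc _ ≤ _ := ENNReal.rpow_le_rpow this (by positivity)
      _ = _ := by rw [← ENNReal.rpow_mul, mul_one_div_cancel hr.ne', ENNReal.rpow_one]

/-- derivative kernel -/
def DK (t : ℝ) (j : Fin 3) (z : E3) : ℝ := -(z j) / (2 * t) * heatKernel t z

/-- second derivative kernel -/
def DDK (t : ℝ) (j : Fin 3) (z : E3) : ℝ := ((z j) ^ 2 / (4 * t ^ 2) - 1 / (2 * t)) * heatKernel t z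

/-- time derivative kernel -/
def TK (t : ℝ) (z : E3) : ℝ := (‖z‖ ^ 2 / (4 * t ^ 2) - 3 / (2 * t)) * heatKernel t z

theorem hk_nonneg {t : ℝ} (ht : 0 < t) (z : E3) : 0 ≤ heatKernel t z := by
  unfold heatKernel; positivity

theorem hk_le {t : ℝ} (ht : 0 < t) (z : E3) : heatKernel t z ≤ (4 * π * t) ^ (-(3 : ℝ) / 2) := by
  unfold heatKernel
  have : Real.exp (-‖z‖ ^ 2 / (4 * t)) ≤ 1 := by
    rw [Real.exp_le_one_iff]
    exact div_nonpos_of_nonpos_of_nonneg (by nlinarith [sq_nonneg ‖z‖]) (by positivity)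
  exact mul_le_of_le_one_right (by positivity) this

theorem hk_neg (t : ℝ) (z : E3) : heatKernel t (-z) = heatKernel t z := by
  simp [heatKernel]

theorem hk_measurable : Measurable (fun q : ℝ × E3 => heatKernel q.1 q.2) := by
  unfold heatKernel; fun_prop

theorem hk_continuous (t : ℝ) : Continuous (heatKernel t) := by
  unfold heatKernel; fun_prop

theorem DK_continuous (t : ℝ) (j : Fin 3) : Continuous (DK t j) := by
  unfold DK; have := hk_continuous t; fun_prop

theorem DDK_continuous (t : ℝ) (j : Fin 3) : Continuous (DDK t j) := by
  unfold DDK; have := hk_continuous t; fun_prop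

theorem TK_continuous (t : ℝ) : Continuous (TK t) := by
  unfold TK; have := hk_continuous t; fun_prop

theorem hk_integral {t : ℝ} (ht : 0 < t) : ∫ z, heatKernel t z = 1 := by
  unfold heatKernel
  rw [integral_const_mul]
  have h := GaussianFourier.integral_rexp_neg_mul_sq_norm (V := E3) (b := 1 / (4 * t)) (by positivity)
  have h2 : ∀ v : E3, -(1 / (4 * t)) * ‖v‖ ^ 2 = -‖v‖ ^ 2 / (4 * t) := fun v => by ring
  simp only [h2] at h
  rw [h]
  have : π / (1 / (4 * t)) = 4 * π * t := by field_simp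
  rw [this, ← Real.rpow_add (by positivity)]
  simp; norm_num

theorem hk_integrable {t : ℝ} (ht : 0 < t) : Integrable (heatKernel t) := by
  by_contra h
  have := hk_integral ht
  rw [integral_undef h] at this
  norm_num at this

theorem abs_coord_le (z : E3) (j : Fin 3) : |z j| ≤ ‖z‖ := by
  simpa using PiLp.norm_apply_le z j

theorem DK_bound {t : ℝ} (ht : 0 < t) (j : Fin 3) (z : E3) :
    |DK t j z| ≤ 3 * t ^ (-(1:ℝ) / 2) * heatKernel (2 * t) z := by
  unfold DK
  rw [abs_mul, abs_of_nonneg (hk_nonneg ht z), abs_div, abs_neg, abs_of_pos (by positivity : 0 < 2 * t)]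
  have h1 : t ^ (-(1:ℝ) / 2) = 1 / √t := by
    rw [neg_div, Real.rpow_neg ht.le, Real.sqrt_eq_rpow, one_div (t ^ ((1:ℝ) / 2))]
  have hst : 0 < √t := Real.sqrt_pos.2 ht
  have hsq : √t ^ 2 = t := Real.sq_sqrt ht.le
  set r := √t with hr
  set a := ‖z‖ / (2 * r) with ha
  have ha0 : 0 ≤ a := by positivity
  have hexp : a ≤ Real.exp (a ^ 2 / 2) := by
    have := Real.add_one_le_exp (a ^ 2 / 2); nlinarith [sq_nonneg (a - 1)]
  have e1 : Real.exp (-‖z‖ ^ 2 / (4 * t)) = Real.exp (-‖z‖ ^ 2 / (4 * (2 * t))) * Real.exp (-(a ^ 2 / 2)) := by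
    rw [← Real.exp_add]; congr 1; rw [ha, ← hsq]; field_simp; ring
  have h2 : (4 * π * t) ^ (-(3 : ℝ) / 2) ≤ 3 * (4 * π * (2 * t)) ^ (-(3 : ℝ) / 2) := by
    have : 4 * π * (2 * t) = 2 * (4 * π * t) := by ring
    rw [this, Real.mul_rpow (x := 2) (y := 4 * π * t) (by positivity) (by positivity)]
    have h3 : 1 ≤ 3 * (2:ℝ) ^ (-(3 : ℝ) / 2) := by
      have h4 : (2:ℝ) ^ (-(3 : ℝ) / 2) = ((2:ℝ) ^ ((3 : ℝ) / 2))⁻¹ := by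
        rw [neg_div, Real.rpow_neg (by norm_num)]
      have h5 : (2:ℝ) ^ ((3 : ℝ) / 2) ≤ 3 := by
        have h6 : ((2:ℝ) ^ ((3 : ℝ) / 2)) ^ 2 = 8 := by
          rw [← Real.rpow_natCast, ← Real.rpow_mul (by norm_num)]; norm_num
        nlinarith [Real.rpow_nonneg (show (0:ℝ) ≤ 2 by norm_num) ((3 : ℝ) / 2)]
      rw [h4, ← div_eq_mul_inv, le_div_iff₀ (by positivity)]; linarith
    have : 0 ≤ (4 * π * t) ^ (-(3 : ℝ) / 2) := by positivity
    nlinarith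
  have h3 : |z j| / (2 * t) ≤ a / r := by
    rw [ha, div_div, ← hsq]
    have := abs_coord_le z j
    have h : 2 * r ^ 2 = 2 * r * r := by ring
    rw [h]
    gcongr
  have h4 : a * Real.exp (-(a ^ 2 / 2)) ≤ 1 := by
    rw [Real.exp_neg, ← div_eq_mul_inv, div_le_one (by positivity)]; exact hexp
  unfold heatKernel
  rw [e1, h1]
  calc _ ≤ a / r * (3 * (4 * π * (2 * t)) ^ (-(3 : ℝ) / 2) *
        (Real.exp (-‖z‖ ^ 2 / (4 * (2 * t))) * Real.exp (-(a ^ 2 / 2)))) := by gcongr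
    _ = 3 * (1 / r) * ((4 * π * (2 * t)) ^ (-(3 : ℝ) / 2) * Real.exp (-‖z‖ ^ 2 / (4 * (2 * t)))) *
        (a * Real.exp (-(a ^ 2 / 2))) := by ring
    _ ≤ _ := mul_le_of_le_one_right (by positivity) h4

theorem sq_mul_hk_le {t : ℝ} (ht : 0 < t) (z : E3) :
    ‖z‖ ^ 2 / (4 * t ^ 2) * heatKernel t z ≤ 1 / t * (4 * π * t) ^ (-(3 : ℝ) / 2) := by
  unfold heatKernel
  have h : ‖z‖ ^ 2 / (4 * t) * Real.exp (-‖z‖ ^ 2 / (4 * t)) ≤ 1 := by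
    rw [neg_div, Real.exp_neg, ← div_eq_mul_inv, div_le_one (by positivity)]
    linarith [Real.add_one_le_exp (‖z‖ ^ 2 / (4 * t))]
  calc _ = 1 / t * (4 * π * t) ^ (-(3 : ℝ) / 2) * (‖z‖ ^ 2 / (4 * t) * Real.exp (-‖z‖ ^ 2 / (4 * t))) := by
        field_simp
    _ ≤ _ := mul_le_of_le_one_right (by positivity) h

theorem TK_bound {t : ℝ} (ht : 0 < t) (z : E3) :
    |TK t z| ≤ 3 / t * (4 * π * t) ^ (-(3 : ℝ) / 2) := by
  unfold TK
  have h1 := sq_mul_hk_le ht z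
  have h2 := hk_le ht z
  have h0 := hk_nonneg ht z
  have h3 : 3 / (2 * t) * heatKernel t z ≤ 3 / (2 * t) * (4 * π * t) ^ (-(3 : ℝ) / 2) := by gcongr
  have h4 : 0 ≤ ‖z‖ ^ 2 / (4 * t ^ 2) * heatKernel t z := by positivity
  have h5 : 0 ≤ 3 / (2 * t) * heatKernel t z := by positivity
  have h6 : 0 ≤ 1 / t * (4 * π * t) ^ (-(3 : ℝ) / 2) := by positivity
  have e2 : 3 / (2 * t) * (4 * π * t) ^ (-(3 : ℝ) / 2) = 3/2 * (1 / t * (4 * π * t) ^ (-(3 : ℝ) / 2)) := by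
    field_simp
  have e3 : 3 / t * (4 * π * t) ^ (-(3 : ℝ) / 2) = 3 * (1 / t * (4 * π * t) ^ (-(3 : ℝ) / 2)) := by
    field_simp
  rw [sub_mul, abs_le]; constructor <;> linarith

theorem DDK_bound {t : ℝ} (ht : 0 < t) (j : Fin 3) (z : E3) :
    |DDK t j z| ≤ 3 / t * (4 * π * t) ^ (-(3 : ℝ) / 2) := by
  unfold DDK
  have h1 := sq_mul_hk_le ht z
  have h2 := hk_le ht z
  have h0 := hk_nonneg ht z
  have h3 : 1 / (2 * t) * heatKernel t z ≤ 1 / (2 * t) * (4 * π * t) ^ (-(3 : ℝ) / 2) := by gcongr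
  have h4 : 0 ≤ (z j) ^ 2 / (4 * t ^ 2) * heatKernel t z := by positivity
  have h7 : (z j) ^ 2 / (4 * t ^ 2) * heatKernel t z ≤ ‖z‖ ^ 2 / (4 * t ^ 2) * heatKernel t z := by
    have : (z j) ^ 2 ≤ ‖z‖ ^ 2 := by rw [← sq_abs (z j)]; gcongr; exact abs_coord_le z j
    gcongr
  have h5 : 0 ≤ 1 / (2 * t) * heatKernel t z := by positivity
  have h6 : 0 ≤ 1 / t * (4 * π * t) ^ (-(3 : ℝ) / 2) := by positivity
  have e2 : 1 / (2 * t) * (4 * π * t) ^ (-(3 : ℝ) / 2) = 1/2 * (1 / t * (4 * π * t) ^ (-(3 : ℝ) / 2)) := by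
    field_simp
  have e3 : 3 / t * (4 * π * t) ^ (-(3 : ℝ) / 2) = 3 * (1 / t * (4 * π * t) ^ (-(3 : ℝ) / 2)) := by
    field_simp
  rw [sub_mul, abs_le]; constructor <;> linarith

theorem TK_eq_sum (t : ℝ) (z : E3) : TK t z = ∑ j, DDK t j z := by
  unfold TK DDK
  rw [EuclideanSpace.norm_sq_eq]
  simp only [Fin.sum_univ_three, Real.norm_eq_abs, sq_abs]
  ring

theorem DK_integrable {t : ℝ} (ht : 0 < t) (j : Fin 3) : Integrable (DK t j) := by
  refine ((hk_integrable (t := 2 * t) (by positivity)).const_mul (3 * t ^ (-(1:ℝ) / 2))).mono'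
    (DK_continuous t j).aestronglyMeasurable ?_
  filter_upwards with z
  exact DK_bound ht j z

theorem hk_prod {s : ℝ} (hs : 0 < s) (a w : E3) :
    heatKernel s (a - w) * heatKernel s (a + w) =
      heatKernel (2 * s) ((2:ℝ) • a) * heatKernel (s / 2) w := by
  unfold heatKernel
  have h := parallelogram_law_with_norm ℝ a w
  have hE : Real.exp (-‖a - w‖ ^ 2 / (4 * s)) * Real.exp (-‖a + w‖ ^ 2 / (4 * s)) =
      Real.exp (-‖(2:ℝ) • a‖ ^ 2 / (4 * (2 * s))) * Real.exp (-‖w‖ ^ 2 / (4 * (s / 2))) := by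
    rw [← Real.exp_add, ← Real.exp_add]; congr 1
    rw [norm_smul, Real.norm_eq_abs, abs_of_pos (by norm_num : (0:ℝ) < 2)]
    field_simp
    linarith
  have hC : (4 * π * s) ^ (-(3 : ℝ) / 2) * (4 * π * s) ^ (-(3 : ℝ) / 2) =
      (4 * π * (2 * s)) ^ (-(3 : ℝ) / 2) * (4 * π * (s / 2)) ^ (-(3 : ℝ) / 2) := by
    rw [← Real.mul_rpow (by positivity) (by positivity), ← Real.mul_rpow (by positivity) (by positivity)]
    congr 1; ring
  calc _ = ((4 * π * s) ^ (-(3 : ℝ) / 2) * (4 * π * s) ^ (-(3 : ℝ) / 2)) *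
      (Real.exp (-‖a - w‖ ^ 2 / (4 * s)) * Real.exp (-‖a + w‖ ^ 2 / (4 * s))) := by ring
    _ = _ := by rw [hE, hC]; ring

theorem DK_odd_integral (s : ℝ) (j : Fin 3) : ∫ z, DK s j z = 0 := by
  have h := integral_neg_eq_self (DK s j) volume
  have h2 : ∀ z, DK s j (-z) = - DK s j z := fun z => by
    unfold DK; rw [hk_neg]; simp; ring
  simp only [h2, integral_neg] at h
  linarith

theorem DK_conv {s : ℝ} (hs : 0 < s) (j : Fin 3) (x z : E3) :
    ∫ y, DK s j (x - y) * heatKernel s (y - z) = DK (2 * s) j (x - z) := by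
  set a : E3 := (2⁻¹ : ℝ) • (x - z) with ha
  have hxz : x - z = (2:ℝ) • a := by rw [ha, smul_smul]; norm_num
  rw [← integral_add_right_eq_self _ (z + a)]
  have h1 : ∀ w : E3, DK s j (x - (w + (z + a))) * heatKernel s (w + (z + a) - z) =
      (-(a j) / (2 * s) * heatKernel (2 * s) ((2:ℝ) • a)) * heatKernel (s / 2) w
       + (- heatKernel (2 * s) ((2:ℝ) • a) / 2) * DK (s / 2) j w := by
    intro w
    have e1 : x - (w + (z + a)) = a - w := by
      have : x = z + (2:ℝ) • a := by rw [← hxz]; abel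
      rw [this, two_smul]; abel
    have e2 : w + (z + a) - z = a + w := by abel
    rw [e1, e2]
    have := hk_prod hs a w
    unfold DK
    rw [mul_assoc, this]
    simp only [PiLp.sub_apply]
    field_simp
    ring
  simp only [h1]
  rw [integral_add ((hk_integrable (by positivity)).const_mul _)
    ((DK_integrable (by positivity) j).const_mul _), integral_const_mul, integral_const_mul,
    hk_integral (by positivity), DK_odd_integral, hxz]
  unfold DK
  simp only [PiLp.smul_apply, smul_eq_mul]
  field_simp
  ring

/-- scalar heat semigroup -/
def Pt (t : ℝ) (f : E3 → ℝ) (x : E3) : ℝ := ∫ y, heatKernel t (x - y) * f y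

theorem bdd_mul_integrable (k : E3 → ℝ) (hk : Continuous k) (C : ℝ) (hC : ∀ z, |k z| ≤ C)
    (f : 𝓢(E3, ℝ)) (x : E3) : Integrable (fun y => k (x - y) * f y) := by
  refine (f.integrable (μ := volume)).bdd_mul (c := C) ?_ ?_
  · exact (by fun_prop : Continuous fun y => k (x - y)).aestronglyMeasurable
  · filter_upwards with y
    exact hC _

theorem DK_bound' {t : ℝ} (ht : 0 < t) (j : Fin 3) (z : E3) :
    |DK t j z| ≤ 3 * t ^ (-(1:ℝ) / 2) * (4 * π * (2 * t)) ^ (-(3 : ℝ) / 2) := by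
  refine (DK_bound ht j z).trans ?_
  have := hk_le (t := 2 * t) (by positivity) z
  gcongr

theorem hk_abs_le {t : ℝ} (ht : 0 < t) (z : E3) :
    |heatKernel t z| ≤ (4 * π * t) ^ (-(3 : ℝ) / 2) := by
  rw [abs_of_nonneg (hk_nonneg ht z)]; exact hk_le ht z

theorem coord_line (z : E3) (j : Fin 3) (r : ℝ) : (z - r • ee j) j = z j - r := by
  simp [ee]

theorem norm_line (z : E3) (j : Fin 3) (r : ℝ) :
    ‖z - r • ee j‖ ^ 2 = ‖z‖ ^ 2 - 2 * r * z j + r ^ 2 := by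
  rw [norm_sub_sq_real]
  simp [ee, norm_smul, inner_smul_right, EuclideanSpace.inner_single_right]
  ring

theorem hk_line {t : ℝ} (ht : 0 < t) (j : Fin 3) (x y : E3) :
    HasLineDerivAt ℝ (fun y => heatKernel t (x - y)) (-DK t j (x - y)) y (ee j) := by
  unfold HasLineDerivAt
  have e : (fun r : ℝ => heatKernel t (x - (y + r • ee j))) = fun r =>
     (4 * π * t) ^ (-(3 : ℝ) / 2) * Real.exp (-(‖x - y‖ ^ 2 - 2 * r * (x - y) j + r ^ 2) / (4 * t)) := by
    ext r
    rw [← norm_line, sub_sub]; rfl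
  rw [e]
  have h1 : HasDerivAt (fun r : ℝ => -(‖x - y‖ ^ 2 - 2 * r * (x - y) j + r ^ 2) / (4 * t))
      ((x - y) j / (2 * t)) 0 := by
    have := (((((hasDerivAt_id (0:ℝ)).const_mul 2).mul_const ((x - y) j)).const_sub (‖x - y‖ ^ 2)).add
      (hasDerivAt_pow 2 (0:ℝ))).neg.div_const (4 * t)
    convert! this using 1
    simp; field_simp; ring
  convert! (h1.exp.const_mul ((4 * π * t) ^ (-(3 : ℝ) / 2))) using 1
  unfold DK heatKernel
  simp; ring

theorem DK_line {t : ℝ} (ht : 0 < t) (j : Fin 3) (x y : E3) :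
    HasLineDerivAt ℝ (fun y => DK t j (x - y)) (-DDK t j (x - y)) y (ee j) := by
  have h := hk_line ht j x y
  unfold HasLineDerivAt at h ⊢
  have e : (fun r : ℝ => DK t j (x - (y + r • ee j))) = fun r =>
     (-((x - y) j - r) / (2 * t)) * heatKernel t (x - (y + r • ee j)) := by
    ext r
    unfold DK
    rw [← coord_line, sub_sub]
  rw [e]
  have h1 : HasDerivAt (fun r : ℝ => (-((x - y) j - r) / (2 * t))) (1 / (2 * t)) 0 := by
    have := ((hasDerivAt_id (0:ℝ)).const_sub ((x - y) j)).neg.div_const (2 * t)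
    convert! this using 1
    simp
  convert! h1.mul h using 1
  unfold DDK DK
  simp; field_simp; ring

theorem ibp (k k' : E3 → ℝ) (hk : Continuous k) (hk' : Continuous k') (C C' : ℝ)
    (hC : ∀ z, |k z| ≤ C) (hC' : ∀ z, |k' z| ≤ C') (j : Fin 3)
    (h : ∀ x y, HasLineDerivAt ℝ (fun y => k (x - y)) (-k' (x - y)) y (ee j))
    (f : 𝓢(E3, ℝ)) (x : E3) :
    ∫ y, k (x - y) * (LineDeriv.lineDerivOp (ee j) f) y = ∫ y, k' (x - y) * f y := by
  have := integral_bilinear_hasLineDerivAt_right_eq_neg_left_of_integrable (μ := volume)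
    (f := fun y => k (x - y)) (f' := fun y => -k' (x - y)) (g := f)
    (g' := LineDeriv.lineDerivOp (ee j) f) (v := ee j) (B := ContinuousLinearMap.mul ℝ ℝ)
    (by simpa using (bdd_mul_integrable k' hk' C' hC' f x).neg)
    (by simpa using bdd_mul_integrable k hk C hC _ x)
    (by simpa using bdd_mul_integrable k hk C hC f x)
    (fun y _ => h x y)
    (fun y _ => by
      rw [SchwartzMap.lineDerivOp_apply_eq_fderiv]
      exact (f.hasFDerivAt y).hasLineDerivAt _)
  simpa [integral_neg] using this

theorem Pt_deriv {t : ℝ} (ht : 0 < t) (j : Fin 3) (f : 𝓢(E3, ℝ)) (x : E3) :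
    Pt t (LineDeriv.lineDerivOp (ee j) f : 𝓢(E3, ℝ)) x = ∫ y, DK t j (x - y) * f y :=
  ibp _ _ (hk_continuous t) (DK_continuous t j) _ _ (hk_abs_le ht) (DK_bound' ht j) j
    (hk_line ht j) f x

theorem Pt_deriv2 {t : ℝ} (ht : 0 < t) (j : Fin 3) (f : 𝓢(E3, ℝ)) (x : E3) :
    Pt t (LineDeriv.lineDerivOp (ee j) (LineDeriv.lineDerivOp (ee j) f : 𝓢(E3, ℝ)) : 𝓢(E3, ℝ)) x
      = ∫ y, DDK t j (x - y) * f y := by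
  rw [Pt_deriv ht]
  exact ibp _ _ (DK_continuous t j) (DDK_continuous t j) _ _ (DK_bound' ht j) (DDK_bound ht j) j
    (DK_line ht j) f x

/-- Laplacian of a Schwartz function. -/
def lap (f : 𝓢(E3, ℝ)) : 𝓢(E3, ℝ) :=
  ∑ j, LineDeriv.lineDerivOp (ee j) (LineDeriv.lineDerivOp (ee j) f : 𝓢(E3, ℝ))

theorem Pt_add {t : ℝ} (ht : 0 < t) (f g : 𝓢(E3, ℝ)) (x : E3) :
    Pt t (f + g : 𝓢(E3, ℝ)) x = Pt t f x + Pt t g x := by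
  unfold Pt
  rw [← integral_add (bdd_mul_integrable _ (hk_continuous t) _ (hk_abs_le ht) f x)
    (bdd_mul_integrable _ (hk_continuous t) _ (hk_abs_le ht) g x)]
  congr 1; ext y; simp; ring

theorem Pt_neg (t : ℝ) (f : 𝓢(E3, ℝ)) (x : E3) :
    Pt t (-f : 𝓢(E3, ℝ)) x = -Pt t f x := by
  unfold Pt
  rw [← integral_neg]
  congr 1; ext y; simp

theorem Pt_sub {t : ℝ} (ht : 0 < t) (f g : 𝓢(E3, ℝ)) (x : E3) :
    Pt t (f - g : 𝓢(E3, ℝ)) x = Pt t f x - Pt t g x := by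
  rw [sub_eq_add_neg, Pt_add ht, Pt_neg]; ring

theorem Pt_lap {t : ℝ} (ht : 0 < t) (f : 𝓢(E3, ℝ)) (x : E3) :
    Pt t (lap f) x = ∫ y, TK t (x - y) * f y := by
  have hI := fun j => bdd_mul_integrable _ (DDK_continuous t j) _ (DDK_bound ht j) f x
  simp only [TK_eq_sum, Finset.sum_mul]
  rw [integral_finsetSum _ (fun j _ => hI j)]
  unfold lap
  simp only [Fin.sum_univ_three]
  rw [Pt_add ht, Pt_add ht, Pt_deriv2 ht, Pt_deriv2 ht, Pt_deriv2 ht]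

theorem hk_time {t : ℝ} (ht : 0 < t) (z : E3) :
    HasDerivAt (fun t => heatKernel t z) (TK t z) t := by
  unfold heatKernel
  have h1 : HasDerivAt (fun t : ℝ => 4 * π * t) (4 * π) t := by
    simpa using (hasDerivAt_id t).const_mul (4 * π)
  have h2 := h1.rpow_const (p := -(3 : ℝ) / 2) (Or.inl (by positivity))
  have h3 : HasDerivAt (fun t : ℝ => -‖z‖ ^ 2 / (4 * t)) (‖z‖ ^ 2 / (4 * t ^ 2)) t := by
    have := (((hasDerivAt_id t).const_mul 4).inv (by simpa using ht.ne')).const_mul (-‖z‖ ^ 2)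
    convert! this using 1
    simp; field_simp; 
  convert! h2.mul h3.exp using 1
  unfold TK heatKernel
  have : (4 * π * t) ^ (-(3 : ℝ) / 2 - 1) = (4 * π * t) ^ (-(3 : ℝ) / 2) / (4 * π * t) := by
    rw [Real.rpow_sub (by positivity), Real.rpow_one]
  rw [this]
  field_simp
  ring

theorem Pt_time {t : ℝ} (ht : 0 < t) (f : 𝓢(E3, ℝ)) (x : E3) :
    HasDerivAt (fun t => Pt t f x) (Pt t (lap f) x) t := by
  rw [Pt_lap ht]
  unfold Pt
  have hpos : ∀ s ∈ Set.Ioi (t / 2), 0 < s := fun s hs => lt_trans (by positivity) hs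
  refine (hasDerivAt_integral_of_dominated_loc_of_deriv_le (s := Set.Ioi (t / 2))
    (F := fun t y => heatKernel t (x - y) * f y)
    (F' := fun t y => TK t (x - y) * f y)
    (bound := fun y => 3 / (t / 2) * (4 * π * (t / 2)) ^ (-(3 : ℝ) / 2) * |f y|)
    (Ioi_mem_nhds (by linarith)) ?_ ?_ ?_ ?_ ?_ ?_).2
  · filter_upwards [Ioi_mem_nhds ht] with s hs
    exact (bdd_mul_integrable _ (hk_continuous s) _ (hk_abs_le hs) f x).aestronglyMeasurable
  · exact (bdd_mul_integrable _ (hk_continuous t) _ (hk_abs_le ht) f x)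
  · exact (bdd_mul_integrable _ (TK_continuous t) _ (TK_bound ht) f x).aestronglyMeasurable
  · filter_upwards with y s hs
    rw [norm_mul, Real.norm_eq_abs, Real.norm_eq_abs]
    have h1 := TK_bound (hpos s hs) (x - y)
    have h2 : 3 / s ≤ 3 / (t / 2) := by
      have : t / 2 ≤ s := le_of_lt hs
      gcongr
    have h3 : (4 * π * s) ^ (-(3 : ℝ) / 2) ≤ (4 * π * (t / 2)) ^ (-(3 : ℝ) / 2) := by
      have : t / 2 ≤ s := le_of_lt hs
      apply Real.rpow_le_rpow_of_nonpos (by positivity) (by gcongr) (by norm_num)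
    have h4 := hpos s hs
    refine mul_le_mul_of_nonneg_right (h1.trans ?_) (abs_nonneg _)
    gcongr
  · exact (f.integrable (μ := volume)).abs.const_mul _
  · filter_upwards with y s hs
    exact (hk_time (hpos s hs) _).mul_const _

theorem int_bound (k : E3 → ℝ) (C : ℝ) (hC : ∀ z, |k z| ≤ C) (f : 𝓢(E3, ℝ)) (x : E3) :
    |∫ y, k (x - y) * f y| ≤ C * ∫ y, |f y| := by
  rw [← integral_const_mul, ← Real.norm_eq_abs]
  refine norm_integral_le_of_norm_le ((f.integrable (μ := volume)).abs.const_mul _) ?_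
  filter_upwards with y
  rw [norm_mul, Real.norm_eq_abs, Real.norm_eq_abs]
  exact mul_le_mul_of_nonneg_right (hC _) (abs_nonneg _)

theorem Pt_tendsto (f : 𝓢(E3, ℝ)) (x : E3) :
    Filter.Tendsto (fun t => Pt t f x) Filter.atTop (nhds 0) := by
  have h0 : Filter.Tendsto (fun t : ℝ => (4 * π * t) ^ (-(3 : ℝ) / 2) * ∫ y, |f y|) Filter.atTop (nhds 0) := by
    have h1 : Filter.Tendsto (fun t : ℝ => (4 * π * t)) Filter.atTop Filter.atTop :=
      Filter.tendsto_id.const_mul_atTop (by positivity)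
    have h2 := (tendsto_rpow_neg_atTop (y := 3 / 2) (by norm_num)).comp h1
    have h3 := h2.mul_const (∫ y, |f y|)
    rw [zero_mul] at h3
    simpa [neg_div] using h3
  refine squeeze_zero_norm' ?_ h0
  filter_upwards [Filter.eventually_gt_atTop 0] with t ht
  exact int_bound _ _ (hk_abs_le ht) f x

theorem Pt_measurable (f : 𝓢(E3, ℝ)) : Measurable (fun q : ℝ × E3 => Pt q.1 f q.2) := by
  unfold Pt
  have h : Measurable (fun q : (ℝ × E3) × E3 => heatKernel q.1.1 (q.1.2 - q.2) * f q.2) := by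
    have := f.continuous.measurable
    unfold heatKernel; fun_prop
  exact (h.stronglyMeasurable.integral_prod_right' (ν := volume)).measurable

theorem Pt_lap_integrable {t : ℝ} (ht : 0 < t) (f : 𝓢(E3, ℝ)) (x : E3) :
    IntegrableOn (fun s => Pt s (lap f) x) (Set.Ioi t) := by
  have hi : IntegrableOn (fun s : ℝ => (3 * (4 * π) ^ (-(3 : ℝ) / 2) * ∫ y, |f y|) * s ^ (-(5:ℝ)/2)) (Set.Ioi t) :=
    (integrableOn_Ioi_rpow_of_lt (by norm_num) ht).const_mul _
  refine hi.mono' ((Pt_measurable (lap f)).comp measurable_prodMk_right).aestronglyMeasurable ?_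
  filter_upwards [ae_restrict_mem measurableSet_Ioi] with s hs
  have hs0 : 0 < s := ht.trans hs
  rw [Pt_lap hs0]
  refine (int_bound _ _ (TK_bound hs0) f x).trans (le_of_eq ?_)
  rw [Real.mul_rpow (by positivity) hs0.le]
  have : s ^ (-(5:ℝ)/2) = s ^ (-(3:ℝ)/2) / s := by
    rw [← Real.rpow_sub_one hs0.ne']; norm_num
  rw [this]; ring

theorem Pt_le_lintegral {t : ℝ} (ht : 0 < t) (f : 𝓢(E3, ℝ)) (x : E3) :
    ‖Pt t f x‖ₑ ≤ ∫⁻ s in Set.Ioi t, ‖Pt s (lap f) x‖ₑ := by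
  have h := integral_Ioi_of_hasDerivAt_of_tendsto' (a := t) (f := fun s => Pt s f x)
    (f' := fun s => Pt s (lap f) x) (m := 0)
    (fun s hs => Pt_time (lt_of_lt_of_le ht hs) f x) (Pt_lap_integrable ht f x) (Pt_tendsto f x)
  have h2 : ‖Pt t f x‖ₑ = ‖∫ s in Set.Ioi t, Pt s (lap f) x‖ₑ := by
    rw [h]; simp
  rw [h2]
  exact enorm_integral_le_lintegral_enorm _

theorem Pt_smooth {s : ℝ} (hs : 0 < s) (j : Fin 3) (f : 𝓢(E3, ℝ)) (x : E3) :
    Pt (2 * s) (LineDeriv.lineDerivOp (ee j) f : 𝓢(E3, ℝ)) x = ∫ y, DK s j (x - y) * Pt s f y := by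
  rw [Pt_deriv (by positivity)]
  simp only [← DK_conv hs]
  unfold Pt
  simp only [← integral_const_mul, ← integral_mul_const]
  rw [integral_integral_swap]
  · simp only [mul_assoc]
  · have h1 : Integrable (fun q : E3 × E3 => f q.1 * DK s j (x - q.2)) (volume.prod volume) :=
      (f.integrable (μ := volume)).mul_prod ((DK_integrable hs j).comp_sub_left x)
    have h2 := h1.bdd_mul (c := (4 * π * s) ^ (-(3 : ℝ) / 2))
      (f := fun q : E3 × E3 => heatKernel s (q.2 - q.1))
      (by
        have := hk_continuous s
        exact (by fun_prop : Continuous fun q : E3 × E3 => heatKernel s (q.2 - q.1)).aestronglyMeasurable)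
      (by
        filter_upwards with q
        exact hk_abs_le hs _)
    refine h2.congr ?_
    filter_upwards with q
    simp only [Function.uncurry]
    ring

theorem eLpNorm_translate (h : E3 → ℝ) (hm : Measurable h) (w : E3) (p : ℝ≥0∞) :
    eLpNorm (fun x => ‖h (x - w)‖ₑ) p volume = eLpNorm h p volume := by
  have h1 : eLpNorm (fun x => ‖h (x - w)‖ₑ) p volume = eLpNorm (h ∘ fun x => x - w) p volume :=
    eLpNorm_enorm _
  rw [h1]
  exact eLpNorm_comp_measurePreserving hm.aestronglyMeasurable (measurePreserving_sub_right volume w)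

theorem smooth_norm {s : ℝ} (hs : 0 < s) (j : Fin 3) (f : 𝓢(E3, ℝ)) (p : ℝ≥0∞) (hp : 1 ≤ p) :
    eLpNorm (Pt (2 * s) (LineDeriv.lineDerivOp (ee j) f : 𝓢(E3, ℝ))) p volume ≤
      ENNReal.ofReal (3 * s ^ (-(1:ℝ) / 2)) * eLpNorm (Pt s f) p volume := by
  set C : ℝ := 3 * s ^ (-(1:ℝ) / 2) with hC
  have hC0 : 0 ≤ C := by positivity
  have hm : Measurable (Pt s f) := (Pt_measurable f).comp measurable_prodMk_left
  have hd : Measurable fun w : E3 => ENNReal.ofReal (C * heatKernel (2 * s) w) :=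
    ((hk_continuous (2 * s)).measurable.const_mul C).ennreal_ofReal
  set ν : Measure E3 := volume.withDensity (fun w => ENNReal.ofReal (C * heatKernel (2 * s) w)) with hν
  have hνu : ν Set.univ = ENNReal.ofReal C := by
    rw [hν, withDensity_apply _ MeasurableSet.univ, Measure.restrict_univ,
      ← ofReal_integral_eq_lintegral_ofReal]
    · rw [integral_const_mul, hk_integral (by positivity), mul_one]
    · exact (hk_integrable (by positivity)).const_mul _
    · filter_upwards with w
      exact mul_nonneg hC0 (hk_nonneg (by positivity) w)
  have : IsFiniteMeasure ν := ⟨by rw [hνu]; exact ENNReal.ofReal_lt_top⟩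
  have hF : Measurable (Function.uncurry fun (x w : E3) => ‖Pt s f (x - w)‖ₑ) := by
    have : Measurable fun q : E3 × E3 => Pt s f (q.1 - q.2) := hm.comp (by fun_prop)
    exact this.enorm
  have key := mink volume ν (fun (x w : E3) => ‖Pt s f (x - w)‖ₑ) hF p hp (eLpNorm (Pt s f) p volume) (by
    filter_upwards with w
    exact le_of_eq (eLpNorm_translate _ hm w p))
  rw [hνu] at key
  refine le_trans (eLpNorm_mono_enorm (fun x => ?_)) key
  rw [enorm_eq_self, Pt_smooth hs]
  calc _ ≤ ∫⁻ y, ‖DK s j (x - y) * Pt s f y‖ₑ := enorm_integral_le_lintegral_enorm _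
    _ = ∫⁻ w, ‖DK s j w * Pt s f (x - w)‖ₑ := by
      rw [← lintegral_sub_left_eq_self _ x]
      simp
    _ ≤ ∫⁻ w, ENNReal.ofReal (C * heatKernel (2 * s) w) * ‖Pt s f (x - w)‖ₑ := by
      refine lintegral_mono fun w => ?_
      rw [enorm_mul]
      gcongr
      rw [Real.enorm_eq_ofReal_abs]
      exact ENNReal.ofReal_le_ofReal (DK_bound hs j w)
    _ = _ := by
      have hFx : Measurable fun w : E3 => ‖Pt s f (x - w)‖ₑ :=
        (hm.comp (measurable_const.sub measurable_id)).enorm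
      rw [hν, lintegral_withDensity_eq_lintegral_mul _ hd hFx]
      rfl

set_option maxHeartbeats 1000000 in
theorem time_norm {t σ c : ℝ} (ht : 0 < t) (hσ : 0 < σ) (hc : 0 < c) (f : 𝓢(E3, ℝ)) (p : ℝ≥0∞)
    (hp : 1 ≤ p) (B : ℝ≥0∞)
    (hB : ∀ s, t < s → eLpNorm (Pt s (lap f)) p volume ≤ ENNReal.ofReal (c * s ^ (-1 - σ / 2)) * B) :
    eLpNorm (Pt t f) p volume ≤ ENNReal.ofReal (c * (2 / σ) * t ^ (-(σ / 2))) * B := by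
  have hd : Measurable fun s : ℝ => ENNReal.ofReal (c * s ^ (-1 - σ / 2)) := by fun_prop
  set ν : Measure ℝ := (volume.restrict (Set.Ioi t)).withDensity
    (fun s => ENNReal.ofReal (c * s ^ (-1 - σ / 2))) with hν
  have hνu : ν Set.univ = ENNReal.ofReal (c * (2 / σ) * t ^ (-(σ / 2))) := by
    rw [hν, withDensity_apply _ MeasurableSet.univ, Measure.restrict_univ,
      ← ofReal_integral_eq_lintegral_ofReal]
    · rw [integral_const_mul, integral_Ioi_rpow_of_lt (by linarith) ht]
      congr 1
      have : -1 - σ / 2 + 1 = -(σ / 2) := by ring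
      rw [this]; field_simp
    · exact (integrableOn_Ioi_rpow_of_lt (by linarith) ht).const_mul _
    · filter_upwards [ae_restrict_mem measurableSet_Ioi] with s hs
      have : 0 < s := ht.trans hs
      simp only [Pi.zero_apply]; positivity
  have : IsFiniteMeasure ν := ⟨by rw [hνu]; exact ENNReal.ofReal_lt_top⟩
  have hPm : Measurable fun q : E3 × ℝ => Pt q.2 (lap f) q.1 :=
    (Pt_measurable (lap f)).comp measurable_swap
  have hF : Measurable (Function.uncurry fun (x : E3) (s : ℝ) =>
      (ENNReal.ofReal (c * s ^ (-1 - σ / 2)))⁻¹ * ‖Pt s (lap f) x‖ₑ) := by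
    exact ((hd.comp measurable_snd).inv).mul hPm.enorm
  have hpos : ∀ s, t < s → ENNReal.ofReal (c * s ^ (-1 - σ / 2)) ≠ 0 := by
    intro s hs
    have : 0 < s := ht.trans hs
    rw [ne_eq, ENNReal.ofReal_eq_zero, not_le]; positivity
  have hae : ∀ᵐ s ∂ν, t < s := by
    have : ν ≪ volume.restrict (Set.Ioi t) := withDensity_absolutelyContinuous _ _
    exact this.ae_le (ae_restrict_mem measurableSet_Ioi)
  have key := mink volume ν _ hF p hp B (by
    filter_upwards [hae] with s hs
    set a := ENNReal.ofReal (c * s ^ (-1 - σ / 2)) with ha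
    have ha0 : a ≠ 0 := hpos s hs
    have hat : a ≠ ∞ := ENNReal.ofReal_ne_top
    have e : (fun x => a⁻¹ * ‖Pt s (lap f) x‖ₑ) =
        fun x => ‖(a⁻¹).toReal • Pt s (lap f) x‖ₑ := by
      ext x
      rw [enorm_smul, Real.enorm_of_nonneg ENNReal.toReal_nonneg,
        ENNReal.ofReal_toReal (ENNReal.inv_ne_top.2 ha0)]
    rw [e, eLpNorm_enorm]
    have e2 := eLpNorm_const_smul (a⁻¹).toReal (Pt s (lap f)) p volume
    rw [Real.enorm_of_nonneg ENNReal.toReal_nonneg,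
        ENNReal.ofReal_toReal (ENNReal.inv_ne_top.2 ha0)] at e2
    refine (le_of_eq e2).trans ?_
    calc _ ≤ a⁻¹ * (a * B) := by gcongr; exact hB s hs
      _ = B := by rw [← mul_assoc, ENNReal.inv_mul_cancel ha0 hat, one_mul])
  rw [hνu] at key
  refine le_trans (eLpNorm_mono_enorm (fun x => ?_)) key
  rw [enorm_eq_self]
  refine (Pt_le_lintegral ht f x).trans (le_of_eq ?_)
  have hFx : Measurable fun s : ℝ => (ENNReal.ofReal (c * s ^ (-1 - σ / 2)))⁻¹ * ‖Pt s (lap f) x‖ₑ :=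
    hd.inv.mul (((Pt_measurable (lap f)).comp measurable_prodMk_right).enorm)
  rw [hν, lintegral_withDensity_eq_lintegral_mul _ hd hFx]
  refine setLIntegral_congr_fun measurableSet_Ioi fun s hs => ?_
  simp only [Pi.mul_apply, Function.comp, Function.uncurry]
  rw [← mul_assoc, ENNReal.mul_inv_cancel (hpos s hs) ENNReal.ofReal_ne_top, one_mul]

theorem heatV_apply (t : ℝ) (v : Fin 3 → E3 → ℝ) (x : E3) (i : Fin 3) :
    heatV t v x i = Pt t (v i) x := rfl

theorem comp_le (t : ℝ) (v : Fin 3 → E3 → ℝ) (p : ℝ≥0∞) (i : Fin 3) :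
    eLpNorm (Pt t (v i)) p volume ≤ eLpNorm (heatV t v) p volume := by
  refine eLpNorm_mono fun x => ?_
  rw [← heatV_apply]
  exact PiLp.norm_apply_le _ i

theorem norm_le_sum (z : E3) : ‖z‖ ≤ ∑ i, |z i| := by
  have h : ‖z‖ ^ 2 ≤ (∑ i, |z i|) ^ 2 := by
    rw [EuclideanSpace.norm_sq_eq]
    simp only [Fin.sum_univ_three, Real.norm_eq_abs]
    have h0 := abs_nonneg (z 0)
    have h1 := abs_nonneg (z 1)
    have h2 := abs_nonneg (z 2)
    nlinarith [mul_nonneg h0 h1, mul_nonneg h0 h2, mul_nonneg h1 h2]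
  exact le_of_sq_le_sq h (Finset.sum_nonneg fun i _ => abs_nonneg _)

theorem heatV_le (t : ℝ) (v : Fin 3 → 𝓢(E3, ℝ)) (p : ℝ≥0∞) (hp : 1 ≤ p) (A : ℝ≥0∞)
    (hA : ∀ i, eLpNorm (Pt t (v i)) p volume ≤ A) :
    eLpNorm (heatV t (fun i => ⇑(v i))) p volume ≤ 3 * A := by
  have h1 : eLpNorm (heatV t (fun i => ⇑(v i))) p volume ≤
      eLpNorm (∑ i : Fin 3, fun x => |Pt t (v i) x|) p volume := by
    refine eLpNorm_mono_real fun x => ?_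
    refine (norm_le_sum _).trans (le_of_eq ?_)
    simp only [heatV_apply, Finset.sum_apply]
  refine h1.trans ((eLpNorm_sum_le (fun i _ => ?_) hp).trans ?_)
  · have hm : Measurable (Pt t (v i)) := (Pt_measurable (v i)).comp measurable_prodMk_left
    exact hm.norm.aestronglyMeasurable
  · calc _ ≤ ∑ i : Fin 3, A := Finset.sum_le_sum fun i _ => by
          have := eLpNorm_norm (p := p) (μ := volume) (Pt t (v i))
          simp only [Real.norm_eq_abs] at this
          rw [this]; exact hA i
      _ = 3 * A := by simp

/-- curl on Schwartz fields -/
def curlS (u : Fin 3 → 𝓢(E3, ℝ)) (i : Fin 3) : 𝓢(E3, ℝ) :=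
  LineDeriv.lineDerivOp (ee (i + 1)) (u (i + 2)) - LineDeriv.lineDerivOp (ee (i + 2)) (u (i + 1))

theorem curl_eq (u : Fin 3 → 𝓢(E3, ℝ)) : curl (fun i => ⇑(u i)) = fun i => ⇑(curlS u i) := by
  funext i x
  fin_cases i <;> rfl

theorem curlS_norm {s : ℝ} (hs : 0 < s) (v : Fin 3 → 𝓢(E3, ℝ)) (i : Fin 3) (p : ℝ≥0∞) (hp : 1 ≤ p) :
    eLpNorm (Pt (2 * s) (curlS v i)) p volume ≤
      ENNReal.ofReal (6 * s ^ (-(1:ℝ) / 2)) * eLpNorm (heatV s (fun i => ⇑(v i))) p volume := by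
  have e : Pt (2 * s) (curlS v i) =
      Pt (2 * s) (LineDeriv.lineDerivOp (ee (i + 1)) (v (i + 2)) : 𝓢(E3, ℝ)) -
      Pt (2 * s) (LineDeriv.lineDerivOp (ee (i + 2)) (v (i + 1)) : 𝓢(E3, ℝ)) := by
    ext x; exact Pt_sub (by positivity) _ _ x
  have hm : ∀ f : 𝓢(E3, ℝ), AEStronglyMeasurable (Pt (2 * s) f) volume := fun f =>
    ((Pt_measurable f).comp measurable_prodMk_left).aestronglyMeasurable
  rw [e]
  refine (eLpNorm_sub_le (hm _) (hm _) hp).trans ?_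
  have h1 := smooth_norm hs (i + 1) (v (i + 2)) p hp
  have h2 := smooth_norm hs (i + 2) (v (i + 1)) p hp
  have h3 := comp_le s (fun i => ⇑(v i)) p
  calc _ ≤ ENNReal.ofReal (3 * s ^ (-(1:ℝ) / 2)) * eLpNorm (heatV s (fun i => ⇑(v i))) p volume +
        ENNReal.ofReal (3 * s ^ (-(1:ℝ) / 2)) * eLpNorm (heatV s (fun i => ⇑(v i))) p volume := by
        refine add_le_add (h1.trans ?_) (h2.trans ?_)
        · gcongr; exact h3 _
        · gcongr; exact h3 _
    _ = _ := by
      rw [← add_mul, ← ENNReal.ofReal_add (by positivity) (by positivity)]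
      congr 2; ring

theorem pd_comm (a b : E3) (f : 𝓢(E3, ℝ)) :
    (LineDeriv.lineDerivOp a (LineDeriv.lineDerivOp b f : 𝓢(E3, ℝ)) : 𝓢(E3, ℝ)) =
      LineDeriv.lineDerivOp b (LineDeriv.lineDerivOp a f : 𝓢(E3, ℝ)) := by
  have key : ∀ (a b x : E3), (LineDeriv.lineDerivOp a (LineDeriv.lineDerivOp b f : 𝓢(E3, ℝ)) : 𝓢(E3, ℝ)) x
      = fderiv ℝ (fderiv ℝ f) x a b := by
    intro a b x
    rw [SchwartzMap.lineDerivOp_apply_eq_fderiv]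
    have e : ⇑(LineDeriv.lineDerivOp b f : 𝓢(E3, ℝ)) = fun y => fderiv ℝ f y b := by
      ext y; rw [SchwartzMap.lineDerivOp_apply_eq_fderiv]
    have hd : DifferentiableAt ℝ (fderiv ℝ f) x :=
      (((f.smooth 2).fderiv_right (m := 1) (by norm_num)).differentiable (by norm_num)) x
    rw [e, fderiv_clm_apply hd (differentiableAt_const b)]
    simp
  ext x
  rw [key, key]
  have : IsSymmSndFDerivAt ℝ f x := by
    refine ((f.smooth 2).contDiffAt).isSymmSndFDerivAt ?_
    simp
  exact this.eq a b

theorem lap_eq (u : Fin 3 → 𝓢(E3, ℝ)) (hu : ∀ x : E3, ∑ i, pd i (⇑(u i)) x = 0) (i : Fin 3) :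
    lap (u i) = - curlS (curlS u) i := by
  have hdiv : (LineDeriv.lineDerivOp (ee 0) (u 0) + LineDeriv.lineDerivOp (ee 1) (u 1) +
      LineDeriv.lineDerivOp (ee 2) (u 2) : 𝓢(E3, ℝ)) = 0 := by
    ext x
    have := hu x
    rw [Fin.sum_univ_three] at this
    exact this
  have hdi := congrArg (fun g : 𝓢(E3, ℝ) => (LineDeriv.lineDerivOp (ee i) g : 𝓢(E3, ℝ))) hdiv
  simp only [LineDeriv.lineDerivOp_add, LineDeriv.lineDerivOp_zero] at hdi
  rw [eq_neg_iff_add_eq_zero, ← hdi]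
  unfold lap curlS
  simp only [sub_eq_add_neg, LineDeriv.lineDerivOp_add, LineDeriv.lineDerivOp_neg, Fin.sum_univ_three]
  fin_cases i <;> simp only [Fin.reduceFinMk, Fin.reduceAdd, Fin.zero_eta, Fin.mk_one, zero_add]
  · rw [pd_comm (ee 0) (ee 1), pd_comm (ee 0) (ee 2)]; abel
  · rw [pd_comm (ee 1) (ee 0), pd_comm (ee 1) (ee 2)]; abel
  · rw [pd_comm (ee 2) (ee 0), pd_comm (ee 2) (ee 1)]; abel

theorem le_besov (s : ℝ) (p : ℝ≥0∞) (f : Fin 3 → E3 → ℝ) {t : ℝ} (ht : 0 < t) :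
    ENNReal.ofReal (t ^ (s / 2)) * eLpNorm (heatV t f) p volume ≤ besov s p f :=
  le_iSup (fun t : Set.Ioi (0 : ℝ) => ENNReal.ofReal ((t : ℝ) ^ (s / 2)) * eLpNorm (heatV t f) p volume)
    ⟨t, ht⟩

theorem heatV_le_besov (s : ℝ) (p : ℝ≥0∞) (f : Fin 3 → E3 → ℝ) {t : ℝ} (ht : 0 < t) :
    eLpNorm (heatV t f) p volume ≤ ENNReal.ofReal (t ^ (-(s / 2))) * besov s p f := by
  calc eLpNorm (heatV t f) p volume
      = ENNReal.ofReal (t ^ (-(s / 2))) * (ENNReal.ofReal (t ^ (s / 2)) * eLpNorm (heatV t f) p volume) := by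
        rw [← mul_assoc, ← ENNReal.ofReal_mul (by positivity), ← Real.rpow_add ht]
        simp
    _ ≤ _ := by gcongr; exact le_besov s p f ht

theorem dir1 (σ : ℝ) (p : ℝ≥0∞) (hp : 1 ≤ p) (u : Fin 3 → 𝓢(E3, ℝ)) :
    besov (σ + 1) p (fun i => ⇑(curlS u i)) ≤
      ENNReal.ofReal (18 * 2 ^ ((σ + 1) / 2)) * besov σ p (fun i => ⇑(u i)) := by
  refine iSup_le fun ⟨t, ht⟩ => ?_
  have ht : 0 < t := ht
  simp only
  have hs : 0 < t / 2 := by positivity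
  set s := t / 2 with hsd
  have hts : t = 2 * s := by rw [hsd]; ring
  have h1 := heatV_le t (curlS u) p hp _ (fun i => by rw [hts]; exact curlS_norm hs u i p hp)
  have h2 := heatV_le_besov σ p (fun i => ⇑(u i)) hs
  calc _ ≤ ENNReal.ofReal (t ^ ((σ + 1) / 2)) * (3 * (ENNReal.ofReal (6 * s ^ (-(1:ℝ) / 2)) *
        (ENNReal.ofReal (s ^ (-(σ / 2))) * besov σ p (fun i => ⇑(u i))))) := by
        gcongr
        exact h1.trans (by gcongr)
    _ = ENNReal.ofReal (t ^ ((σ + 1) / 2)) * (ENNReal.ofReal 3) * ENNReal.ofReal (6 * s ^ (-(1:ℝ) / 2)) *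
        ENNReal.ofReal (s ^ (-(σ / 2))) * besov σ p (fun i => ⇑(u i)) := by
        rw [ENNReal.ofReal_ofNat]; ring
    _ = _ := by
      rw [← ENNReal.ofReal_mul (by positivity), ← ENNReal.ofReal_mul (by positivity),
        ← ENNReal.ofReal_mul (by positivity)]
      congr 2
      rw [hts, Real.mul_rpow (by norm_num) hs.le]
      have : s ^ ((σ + 1) / 2) * s ^ (-(1:ℝ) / 2) * s ^ (-(σ / 2)) = 1 := by
        rw [← Real.rpow_add hs, ← Real.rpow_add hs]
        ring_nf
        simp
      linear_combination (18 * 2 ^ ((σ + 1) / 2)) * this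

theorem dir2 (σ : ℝ) (hσ : 0 < σ) (p : ℝ≥0∞) (hp : 1 ≤ p) (u : Fin 3 → 𝓢(E3, ℝ))
    (hu : ∀ x : E3, ∑ i, pd i (⇑(u i)) x = 0) :
    besov σ p (fun i => ⇑(u i)) ≤
      ENNReal.ofReal (18 * 2 ^ (1 + σ / 2) * (2 / σ)) * besov (σ + 1) p (fun i => ⇑(curlS u i)) := by
  refine iSup_le fun ⟨t, ht⟩ => ?_
  have ht : 0 < t := ht
  simp only
  set B := besov (σ + 1) p (fun i => ⇑(curlS u i)) with hB
  have h1 := heatV_le t u p hp _ (fun i => time_norm (c := 6 * 2 ^ (1 + σ / 2)) ht hσ (by positivity)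
    (u i) p hp B (by
    intro r hr
    have hr0 : 0 < r := ht.trans hr
    have hs : 0 < r / 2 := by positivity
    have e : Pt r (lap (u i)) = - Pt r (curlS (curlS u) i) := by
      ext x; rw [lap_eq u hu]; exact Pt_neg r _ x
    rw [e, eLpNorm_neg]
    have h2 := curlS_norm hs (curlS u) i p hp
    have h3 := heatV_le_besov (σ + 1) p (fun i => ⇑(curlS u i)) hs
    rw [mul_div_cancel₀ r (two_ne_zero)] at h2
    calc _ ≤ ENNReal.ofReal (6 * (r / 2) ^ (-(1:ℝ) / 2)) *
          (ENNReal.ofReal ((r / 2) ^ (-((σ + 1) / 2))) * B) := h2.trans (by gcongr)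
      _ = _ := by
        rw [← mul_assoc, ← ENNReal.ofReal_mul (by positivity), mul_assoc, ← Real.rpow_add hs]
        congr 2
        have : -(1:ℝ) / 2 + -((σ + 1) / 2) = -1 - σ / 2 := by ring
        rw [this, div_eq_mul_inv, Real.mul_rpow hr0.le (by norm_num), Real.inv_rpow (by norm_num),
          ← Real.rpow_neg (by norm_num)]
        have : -(-1 - σ / 2) = 1 + σ / 2 := by ring
        rw [this]; ring))
  calc _ ≤ ENNReal.ofReal (t ^ (σ / 2)) * (3 *
        (ENNReal.ofReal (6 * 2 ^ (1 + σ / 2) * (2 / σ) * t ^ (-(σ / 2))) * B)) := by gcongr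
    _ = ENNReal.ofReal (t ^ (σ / 2)) * ENNReal.ofReal 3 *
        ENNReal.ofReal (6 * 2 ^ (1 + σ / 2) * (2 / σ) * t ^ (-(σ / 2))) * B := by
        rw [ENNReal.ofReal_ofNat]; ring
    _ = _ := by
      rw [← ENNReal.ofReal_mul (by positivity), ← ENNReal.ofReal_mul (by positivity)]
      congr 2
      have : t ^ (σ / 2) * t ^ (-(σ / 2)) = 1 := by
        rw [← Real.rpow_add ht]; simp
      linear_combination (18 * 2 ^ (1 + σ / 2) * (2 / σ)) * this

end helpers

/-- For `3 < p ≤ ∞` there is `M_p > 0` such that for every divergence-free Schwartz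
vector field `u` with vorticity `ω = ∇×u`,
`(1/M_p)‖ω‖_{Ḃ^{−2+3/p}_{p,∞}} ≤ ‖u‖_{Ḃ^{−1+3/p}_{p,∞}} ≤ M_p‖ω‖_{Ḃ^{−2+3/p}_{p,∞}}`. -/
theorem statement18 (p : ℝ≥0∞) (hp : 3 < p) :
    ∃ M : ℝ, 0 < M ∧ ∀ u : Fin 3 → 𝓢(E3, ℝ),
      (∀ x : E3, ∑ i, pd i (⇑(u i)) x = 0) →
      ENNReal.ofReal (1 / M) * besov (2 - 3 / p.toReal) p (curl (fun i => ⇑(u i))) ≤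
          besov (1 - 3 / p.toReal) p (fun i => ⇑(u i)) ∧
        besov (1 - 3 / p.toReal) p (fun i => ⇑(u i)) ≤
          ENNReal.ofReal M * besov (2 - 3 / p.toReal) p (curl (fun i => ⇑(u i))) := by
  set σ : ℝ := 1 - 3 / p.toReal with hσd
  have h2 : 2 - 3 / p.toReal = σ + 1 := by rw [hσd]; ring
  have hp1 : 1 ≤ p := le_trans (by norm_num) hp.le
  have hσ : 0 < σ := by
    rw [hσd]
    rcases eq_or_ne p ∞ with rfl | hpt
    · simp
    · have h3 : 3 < p.toReal := by
        have := (ENNReal.toReal_lt_toReal (by norm_num) hpt).2 hp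
        simpa using this
      have : 3 / p.toReal < 1 := by rw [div_lt_one (by linarith)]; exact h3
      linarith
  have hA : 0 < (18 * 2 ^ ((σ + 1) / 2) : ℝ) := by positivity
  have hB : 0 < (18 * 2 ^ (1 + σ / 2) * (2 / σ) : ℝ) := by positivity
  refine ⟨18 * 2 ^ ((σ + 1) / 2) + 18 * 2 ^ (1 + σ / 2) * (2 / σ), by positivity, fun u hu => ?_⟩
  rw [h2, curl_eq]
  set M : ℝ := 18 * 2 ^ ((σ + 1) / 2) + 18 * 2 ^ (1 + σ / 2) * (2 / σ) with hM
  have hM0 : 0 < M := by positivity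
  constructor
  · calc _ ≤ ENNReal.ofReal (1 / M) * (ENNReal.ofReal M * besov σ p (fun i => ⇑(u i))) := by
          gcongr
          refine (dir1 σ p hp1 u).trans ?_
          gcongr
          linarith
      _ = _ := by
          rw [← mul_assoc, ← ENNReal.ofReal_mul (by positivity), one_div_mul_cancel hM0.ne']
          simp
  · refine (dir2 σ hσ p hp1 u hu).trans ?_
    gcongr
    linarith
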